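/- arXiv:2109.06049 — 4 statements merged into one kernel-verified Lean document; each statement's English description precedes it below -/
import Mathlib

section
/- For an ma-hypergraph G, monos m : G → H and m' : G → H' between monogamous acyclic hypergraphs with m ≲ m', and any mono k : K → G from an ma-hypergraph K, it holds that m ∘ k ≲ m' ∘ k. -/
namespace HypRw

/-- A hypergraph over a signature `Sg` with arity `ar` and coarity `coar`:
finite sets of nodes and hyperedges, source and target lists, and labels
compatible with arities. -/
structure Hypergraph (Sg : Type) (ar coar : Sg → ℕ) : Type 1 where
  V : Type
  E : Type
  fintV : Fintype V
  fintE : Fintype E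
  label : E → Sg
  src : E → List V
  tgt : E → List V
  src_len : ∀ e, (src e).length = ar (label e)
  tgt_len : ∀ e, (tgt e).length = coar (label e)

attribute [instance] Hypergraph.fintV Hypergraph.fintE

variable {Sg : Type} {ar coar : Sg → ℕ}

/-- Morphisms of hypergraphs: functions on nodes and hyperedges preserving
sources, targets and labels. -/
structure Hom (G H : Hypergraph Sg ar coar) : Type where
  onV : G.V → H.V
  onE : G.E → H.E
  label_eq : ∀ e, H.label (onE e) = G.label e
  src_eq : ∀ e, H.src (onE e) = (G.src e).map onV
  tgt_eq : ∀ e, H.tgt (onE e) = (G.tgt e).map onV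

def Hom.comp {G H K : Hypergraph Sg ar coar} (g : Hom H K) (f : Hom G H) : Hom G K where
  onV := g.onV ∘ f.onV
  onE := g.onE ∘ f.onE
  label_eq e := by simp [Function.comp, g.label_eq, f.label_eq]
  src_eq e := by simp [Function.comp, g.src_eq, f.src_eq, List.map_map]
  tgt_eq e := by simp [Function.comp, g.tgt_eq, f.tgt_eq, List.map_map]

def Hom.id (G : Hypergraph Sg ar coar) : Hom G G where
  onV := _root_.id
  onE := _root_.id
  label_eq e := rfl
  src_eq e := by simp
  tgt_eq e := by simp

/-- A morphism is mono iff it is injective on nodes and hyperedges. -/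
def IsMono {G H : Hypergraph Sg ar coar} (f : Hom G H) : Prop :=
  Function.Injective f.onV ∧ Function.Injective f.onE

/-- In-degree of a node: the number of pairs (h,i) with `v` the i-th target of `h`. -/
noncomputable def Hypergraph.inDegree (G : Hypergraph Sg ar coar) (v : G.V) : ℕ :=
  letI := Classical.decEq G.V
  ∑ e : G.E, (G.tgt e).count v

/-- Out-degree of a node: the number of pairs (h,i) with `v` the i-th source of `h`. -/
noncomputable def Hypergraph.outDegree (G : Hypergraph Sg ar coar) (v : G.V) : ℕ :=
  letI := Classical.decEq G.V
  ∑ e : G.E, (G.src e).count v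

def Hypergraph.IsInput (G : Hypergraph Sg ar coar) (v : G.V) : Prop := G.inDegree v = 0
def Hypergraph.IsOutput (G : Hypergraph Sg ar coar) (v : G.V) : Prop := G.outDegree v = 0

/-- Two hyperedges are consecutive in a path when some target of the first is a
source of the second. -/
def EdgeStep (G : Hypergraph Sg ar coar) (e e' : G.E) : Prop :=
  ∃ v, v ∈ G.tgt e ∧ v ∈ G.src e'

/-- `p` is a (directed) path in `G` from node `x` to node `y`. -/
def IsPathFromTo (G : Hypergraph Sg ar coar) (p : List G.E) (x y : G.V) : Prop :=
  ∃ hp : p ≠ [], List.Chain' (EdgeStep G) p ∧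
    x ∈ G.src (p.head hp) ∧ y ∈ G.tgt (p.getLast hp)

def HasPath (G : Hypergraph Sg ar coar) (x y : G.V) : Prop :=
  ∃ p, IsPathFromTo G p x y

/-- `G` contains a (directed) cycle. -/
def Hypergraph.HasCycle (G : Hypergraph Sg ar coar) : Prop :=
  ∃ (p : List G.E) (hp : p ≠ []), List.Chain' (EdgeStep G) p ∧
    EdgeStep G (p.getLast hp) (p.head hp)

/-- Every node has in-degree ≤ 1 and out-degree ≤ 1. -/
def Hypergraph.Monogamous (G : Hypergraph Sg ar coar) : Prop :=
  ∀ v, G.inDegree v ≤ 1 ∧ G.outDegree v ≤ 1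

/-- Monogamous acyclic hypergraph. -/
def Hypergraph.IsMA (G : Hypergraph Sg ar coar) : Prop :=
  ¬ G.HasCycle ∧ G.Monogamous

/-- `m' : G → H'` path-covers `m : G → H` (written m ≲ m'): the path relation
`R_m ⊆ out(G) × in(G)` is contained in `R_{m'}`. -/
def PathCovers {G H H' : Hypergraph Sg ar coar} (m : Hom G H) (m' : Hom G H') : Prop :=
  ∀ y x, G.IsOutput y → G.IsInput x →
    HasPath H (m.onV y) (m.onV x) → HasPath H' (m'.onV y) (m'.onV x)

/-- An ma-cospan `n → G ← m` (interfaces discrete): `G` is ma, the legs are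
injective with images exactly the inputs resp. outputs of `G`. -/
def IsMACospan (G : Hypergraph Sg ar coar) {α β : Type}
    (i : α → G.V) (o : β → G.V) : Prop :=
  G.IsMA ∧ Function.Injective i ∧ Set.range i = {v | G.IsInput v} ∧
    Function.Injective o ∧ Set.range o = {v | G.IsOutput v}

/-- Every input is connected by a path to every output. -/
def Hypergraph.StronglyConnected (G : Hypergraph Sg ar coar) : Prop :=
  ∀ x y, G.IsInput x → G.IsOutput y → HasPath G x y

/-- The discrete hypergraph on a finite set of nodes. -/
def Discrete (α : Type) [Fintype α] : Hypergraph Sg ar coar where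
  V := α
  E := Empty
  fintV := inferInstance
  fintE := inferInstance
  label e := e.elim
  src e := e.elim
  tgt e := e.elim
  src_len e := e.elim
  tgt_len e := e.elim

/-- The hypergraph morphism from a discrete hypergraph induced by a function on nodes. -/
def discHom {α : Type} [Fintype α] (G : Hypergraph Sg ar coar) (f : α → G.V) :
    Hom (Discrete α) G where
  onV := f
  onE e := e.elim
  label_eq e := e.elim
  src_eq e := e.elim
  tgt_eq e := e.elim

/-- Pushout square of hypergraphs (universal property). -/
def IsPushout {A B C D : Hypergraph Sg ar coar}
    (f : Hom A B) (g : Hom A C) (h : Hom B D) (k : Hom C D) : Prop :=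
  h.comp f = k.comp g ∧
    ∀ (X : Hypergraph Sg ar coar) (u : Hom B X) (v : Hom C X),
      u.comp f = v.comp g → ∃! w : Hom D X, w.comp h = u ∧ w.comp k = v

/-- Pullback square of hypergraphs (universal property). -/
def IsPullback {A B C D : Hypergraph Sg ar coar}
    (p : Hom A B) (q : Hom A C) (f : Hom B D) (g : Hom C D) : Prop :=
  f.comp p = g.comp q ∧
    ∀ (X : Hypergraph Sg ar coar) (u : Hom X B) (v : Hom X C),
      f.comp u = g.comp v → ∃! w : Hom X A, p.comp w = u ∧ q.comp w = v

/-- A convex match: a mono whose image is convex, i.e. every path in `G`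
between two nodes of the image has all its hyperedges in the image. -/
def IsConvexMatch {L G : Hypergraph Sg ar coar} (f : Hom L G) : Prop :=
  IsMono f ∧
    ∀ (v v' : L.V) (p : List G.E) (hp : p ≠ []),
      List.Chain' (EdgeStep G) p →
      f.onV v ∈ G.src (p.head hp) → f.onV v' ∈ G.tgt (p.getLast hp) →
      ∀ e ∈ p, ∃ e₀, f.onE e₀ = e

/-- An ma-rule `L ← i+j → R`: both `i → L ← j` and `i → R ← j` are ma-cospans. -/
structure MARule (Sg : Type) (ar coar : Sg → ℕ) : Type 1 where
  i : ℕ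
  j : ℕ
  L : Hypergraph Sg ar coar
  R : Hypergraph Sg ar coar
  lhsIn : Fin i → L.V
  lhsOut : Fin j → L.V
  rhsIn : Fin i → R.V
  rhsOut : Fin j → R.V
  ma_lhs : IsMACospan L lhsIn lhsOut
  ma_rhs : IsMACospan R rhsIn rhsOut

/-- A rule is left-linear when `i+j → L` is mono. -/
def MARule.IsLeftLinear (r : MARule Sg ar coar) : Prop :=
  Function.Injective (Sum.elim r.lhsIn r.lhsOut)

/-- A boundary complement of a mono `f : L → G` with respect to ma-cospans
`i → L ← j` and `n → G ← m`: a pushout complement `i+j → C → G` with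
`i+j → C` mono, together with `d1, d2` making `j+n → C ← m+i` an ma-cospan. -/
structure BoundaryComplement {i j n m : ℕ} {L G : Hypergraph Sg ar coar}
    (a1 : Fin i → L.V) (a2 : Fin j → L.V) (b1 : Fin n → G.V) (b2 : Fin m → G.V)
    (f : Hom L G) : Type 1 where
  C : Hypergraph Sg ar coar
  c1 : Fin i → C.V
  c2 : Fin j → C.V
  g : Hom C G
  po : IsPushout (discHom L (Sum.elim a1 a2)) (discHom C (Sum.elim c1 c2)) f g
  c_mono : Function.Injective (Sum.elim c1 c2)
  d1 : Fin n → C.V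
  d2 : Fin m → C.V
  g_d1 : g.onV ∘ d1 = b1
  g_d2 : g.onV ∘ d2 = b2
  bc_ma : IsMACospan C (Sum.elim c2 d1) (Sum.elim d2 c1)

/-- The data of a convex DPO rewriting step `(D ← n+m) ⇝ (E ← n+m)` applying an
ma-rule `r` at a convex match via a boundary complement. -/
structure StepData (r : MARule Sg ar coar) {n m : ℕ}
    (D : Hypergraph Sg ar coar) (dIn : Fin n → D.V) (dOut : Fin m → D.V)
    (E : Hypergraph Sg ar coar) (eIn : Fin n → E.V) (eOut : Fin m → E.V) : Type 1 where
  f : Hom r.L D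
  C : Hypergraph Sg ar coar
  c1 : Fin r.i → C.V
  c2 : Fin r.j → C.V
  g : Hom C D
  h : Hom C E
  comatch : Hom r.R E
  d1 : Fin n → C.V
  d2 : Fin m → C.V
  maD : IsMACospan D dIn dOut
  maE : IsMACospan E eIn eOut
  convex : IsConvexMatch f
  po_left : IsPushout (discHom r.L (Sum.elim r.lhsIn r.lhsOut))
    (discHom C (Sum.elim c1 c2)) f g
  c_mono : Function.Injective (Sum.elim c1 c2)
  g_d1 : g.onV ∘ d1 = dIn
  g_d2 : g.onV ∘ d2 = dOut
  bc_ma : IsMACospan C (Sum.elim c2 d1) (Sum.elim d2 c1)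
  po_right : IsPushout (discHom r.R (Sum.elim r.rhsIn r.rhsOut))
    (discHom C (Sum.elim c1 c2)) comatch h
  h_d1 : h.onV ∘ d1 = eIn
  h_d2 : h.onV ∘ d2 = eOut

/-- Convex rewriting step with respect to a rewriting system `Rs`. -/
def ConvexStep (Rs : Set (MARule Sg ar coar)) {n m : ℕ}
    (D : Hypergraph Sg ar coar) (dIn : Fin n → D.V) (dOut : Fin m → D.V)
    (E : Hypergraph Sg ar coar) (eIn : Fin n → E.V) (eOut : Fin m → E.V) : Prop :=
  ∃ r ∈ Rs, Nonempty (StepData r D dIn dOut E eIn eOut)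

/-- A hypergraph with an (n,m)-interface. -/
structure IGraph (Sg : Type) (ar coar : Sg → ℕ) (n m : ℕ) : Type 1 where
  G : Hypergraph Sg ar coar
  iIn : Fin n → G.V
  iOut : Fin m → G.V

def StepRel (Rs : Set (MARule Sg ar coar)) {n m : ℕ}
    (X Y : IGraph Sg ar coar n m) : Prop :=
  ConvexStep Rs X.G X.iIn X.iOut Y.G Y.iIn Y.iOut

/-- Joinability: both rewrite (in finitely many convex steps) to a common
ma-hypergraph with interface. -/
def Joinable (Rs : Set (MARule Sg ar coar)) {n m : ℕ}
    (X Y : IGraph Sg ar coar n m) : Prop :=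
  ∃ W, Relation.ReflTransGen (StepRel Rs) X W ∧ Relation.ReflTransGen (StepRel Rs) Y W

/-- An ma-pre-critical pair: two convex rewriting steps from a common source
`S ← n+m` such that the combined match `L1 + L2 → S` is epi and `S ← n+m` is an
ma-hypergraph with interface. -/
structure MAPreCriticalPair (r1 r2 : MARule Sg ar coar) {n m : ℕ}
    (S : Hypergraph Sg ar coar) (sIn : Fin n → S.V) (sOut : Fin m → S.V)
    (H1 : Hypergraph Sg ar coar) (h1In : Fin n → H1.V) (h1Out : Fin m → H1.V)
    (H2 : Hypergraph Sg ar coar) (h2In : Fin n → H2.V) (h2Out : Fin m → H2.V) :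
    Type 1 where
  step1 : StepData r1 S sIn sOut H1 h1In h1Out
  step2 : StepData r2 S sIn sOut H2 h2In h2Out
  epiV : ∀ v : S.V, (∃ x, step1.f.onV x = v) ∨ (∃ x, step2.f.onV x = v)
  epiE : ∀ e : S.E, (∃ x, step1.f.onE x = e) ∨ (∃ x, step2.f.onE x = e)

/-! ### The extended signature Σ + 𝒫 with the three formal path generators -/

abbrev ESig (Sg : Type) : Type := Sg ⊕ Fin 3

/-- Arities of Σ + 𝒫: the generators have arities 2, 1, 1. -/
def ear (ar : Sg → ℕ) : ESig Sg → ℕ :=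
  Sum.elim ar (fun g => if g = (0 : Fin 3) then 2 else 1)

/-- Coarities of Σ + 𝒫: the generators have coarities 1, 2, 1. -/
def ecoar (coar : Sg → ℕ) : ESig Sg → ℕ :=
  Sum.elim coar (fun g => if g = (1 : Fin 3) then 2 else 1)

abbrev EHypergraph (Sg : Type) (ar coar : Sg → ℕ) : Type 1 :=
  Hypergraph (ESig Sg) (ear ar) (ecoar coar)

/-- A hypergraph over Σ + 𝒫 labelled only by Σ. -/
def Pure (G : EHypergraph Sg ar coar) : Prop :=
  ∀ e : G.E, (G.label e).isLeft = true

/-- A path extension of `G` realizing the relation `R ⊆ out(G) × in(G)`: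
a mono `p : G → P` whose complement consists only of extra nodes and
𝒫-labelled hyperedges, with a path in `P` from `p y` to `p x` (for `y` an
output and `x` an input of `G`) iff `(y,x) ∈ R`. -/
def IsPathExtension {G P : EHypergraph Sg ar coar}
    (p : Hom G P) (R : G.V → G.V → Prop) : Prop :=
  IsMono p ∧ (∀ e : P.E, (¬ ∃ e₀, p.onE e₀ = e) → (P.label e).isRight = true) ∧
    ∀ y x, G.IsOutput y → G.IsInput x → (HasPath P (p.onV y) (p.onV x) ↔ R y x)

/-- A path extension (realizing its own path relation). -/
def IsPathExt {G P : EHypergraph Sg ar coar} (p : Hom G P) : Prop :=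
  IsMono p ∧ ∀ e : P.E, (¬ ∃ e₀, p.onE e₀ = e) → (P.label e).isRight = true

/-- Condition (1)-(2) of Definition of maximal path relations: `R` is the path
relation of some mono of `S` into an ma-hypergraph for which both induced
matches are convex. -/
def SatPR {r1 r2 : MARule (ESig Sg) (ear ar) (ecoar coar)} {n m : ℕ}
    {S : EHypergraph Sg ar coar} {sIn : Fin n → S.V} {sOut : Fin m → S.V}
    {H1 : EHypergraph Sg ar coar} {h1In : Fin n → H1.V} {h1Out : Fin m → H1.V}
    {H2 : EHypergraph Sg ar coar} {h2In : Fin n → H2.V} {h2Out : Fin m → H2.V}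
    (cp : MAPreCriticalPair r1 r2 S sIn sOut H1 h1In h1Out H2 h2In h2Out)
    (R : S.V → S.V → Prop) : Prop :=
  ∃ (H : EHypergraph Sg ar coar) (mh : Hom S H), IsMono mh ∧ H.IsMA ∧
    (∀ y x, R y x ↔ (S.IsOutput y ∧ S.IsInput x ∧ HasPath H (mh.onV y) (mh.onV x))) ∧
    IsConvexMatch (mh.comp cp.step1.f) ∧ IsConvexMatch (mh.comp cp.step2.f)

/-- A maximal path relation for an ma-pre-critical pair. -/
def MaxPR {r1 r2 : MARule (ESig Sg) (ear ar) (ecoar coar)} {n m : ℕ}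
    {S : EHypergraph Sg ar coar} {sIn : Fin n → S.V} {sOut : Fin m → S.V}
    {H1 : EHypergraph Sg ar coar} {h1In : Fin n → H1.V} {h1Out : Fin m → H1.V}
    {H2 : EHypergraph Sg ar coar} {h2In : Fin n → H2.V} {h2Out : Fin m → H2.V}
    (cp : MAPreCriticalPair r1 r2 S sIn sOut H1 h1In h1Out H2 h2In h2Out)
    (R : S.V → S.V → Prop) : Prop :=
  SatPR cp R ∧ ∀ R', SatPR cp R' → (∀ y x, R y x → R' y x) → ∀ y x, R' y x → R y x

/-- An ma-pre-critical pair is path joinable if for every maximal path relation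
`R` there is a path extension `p` with `R_p = R` such that the branching
obtained by lifting the two rewriting steps along `p` is joinable by convex
rewriting. -/
def PathJoinable (Rs : Set (MARule (ESig Sg) (ear ar) (ecoar coar)))
    {r1 r2 : MARule (ESig Sg) (ear ar) (ecoar coar)} {n m : ℕ}
    {S : EHypergraph Sg ar coar} {sIn : Fin n → S.V} {sOut : Fin m → S.V}
    {H1 : EHypergraph Sg ar coar} {h1In : Fin n → H1.V} {h1Out : Fin m → H1.V}
    {H2 : EHypergraph Sg ar coar} {h2In : Fin n → H2.V} {h2Out : Fin m → H2.V}
    (cp : MAPreCriticalPair r1 r2 S sIn sOut H1 h1In h1Out H2 h2In h2Out) : Prop :=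
  ∀ R, MaxPR cp R →
    ∃ (P : EHypergraph Sg ar coar) (p : Hom S P), IsPathExtension p R ∧
      ∃ (pIn : Fin n → P.V) (pOut : Fin m → P.V)
        (P1 : EHypergraph Sg ar coar) (p1In : Fin n → P1.V) (p1Out : Fin m → P1.V)
        (P2 : EHypergraph Sg ar coar) (p2In : Fin n → P2.V) (p2Out : Fin m → P2.V)
        (sd1 : StepData r1 P pIn pOut P1 p1In p1Out)
        (sd2 : StepData r2 P pIn pOut P2 p2In p2Out),
        sd1.f = p.comp cp.step1.f ∧ sd2.f = p.comp cp.step2.f ∧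
        Joinable Rs ⟨P1, p1In, p1Out⟩ ⟨P2, p2In, p2Out⟩

/-- `u` is a source and `v` a target of some common hyperedge. -/
def NodeStep (G : Hypergraph Sg ar coar) (u v : G.V) : Prop :=
  ∃ e, u ∈ G.src e ∧ v ∈ G.tgt e

theorem hasPath_iff_transGen {G : Hypergraph Sg ar coar} {x y : G.V} :
    HasPath G x y ↔ Relation.TransGen (NodeStep G) x y := by
  constructor
  · rintro ⟨p, hp, hc, hx, hy⟩
    induction p generalizing x with
    | nil => exact absurd rfl hp
    | cons e p ih =>
      cases p with
      | nil => exact .single ⟨e, hx, hy⟩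
      | cons e' q =>
        obtain ⟨⟨v, hv, hv'⟩, hq⟩ := List.isChain_cons_cons.1 hc
        exact .head ⟨e, hx, hv⟩ (ih (List.cons_ne_nil _ _) hq hv' hy)
  · intro h
    induction h using Relation.TransGen.head_induction_on with
    | single h =>
      obtain ⟨e, hu, hv⟩ := h
      exact ⟨[e], List.cons_ne_nil _ _, List.isChain_singleton _, hu, hv⟩
    | head h _ ih =>
      obtain ⟨e, hu, hv⟩ := h
      obtain ⟨p, hp, hc, hx, hy⟩ := ih
      cases p with
      | nil => exact absurd rfl hp
      | cons e' q =>
        exact ⟨e :: e' :: q, List.cons_ne_nil _ _,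
          List.isChain_cons_cons.2 ⟨⟨_, hv, hx⟩, hc⟩, hu, hy⟩

theorem _root_.List.eq_of_sum_count_le_one {ι α : Type*} [Fintype ι] [DecidableEq α]
    {l : ι → List α} {a : α} (h : ∑ i, (l i).count a ≤ 1) {i j : ι}
    (hi : a ∈ l i) (hj : a ∈ l j) : i = j := by
  classical
  by_contra hij
  have hle : ∑ x ∈ {i, j}, (l x).count a ≤ ∑ x, (l x).count a :=
    Finset.sum_le_sum_of_subset (Finset.subset_univ _)
  rw [Finset.sum_pair hij] at hle
  have := List.count_pos_iff.2 hi
  have := List.count_pos_iff.2 hj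
  omega

theorem Hypergraph.Monogamous.eq_of_mem_src {G : Hypergraph Sg ar coar} (h : G.Monogamous)
    {v : G.V} {e e' : G.E} (he : v ∈ G.src e) (he' : v ∈ G.src e') : e = e' := by
  classical
  exact List.eq_of_sum_count_le_one (h v).2 he he'

theorem Hypergraph.Monogamous.eq_of_mem_tgt {G : Hypergraph Sg ar coar} (h : G.Monogamous)
    {v : G.V} {e e' : G.E} (he : v ∈ G.tgt e) (he' : v ∈ G.tgt e') : e = e' := by
  classical
  exact List.eq_of_sum_count_le_one (h v).1 he he'

theorem Hypergraph.isOutput_iff {G : Hypergraph Sg ar coar} {v : G.V} :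
    G.IsOutput v ↔ ∀ e, v ∉ G.src e := by
  simp [Hypergraph.IsOutput, Hypergraph.outDegree, List.count_eq_zero]

theorem Hypergraph.isInput_iff {G : Hypergraph Sg ar coar} {v : G.V} :
    G.IsInput v ↔ ∀ e, v ∉ G.tgt e := by
  simp [Hypergraph.IsInput, Hypergraph.inDegree, List.count_eq_zero]

theorem Hom.mem_src_onE {G H : Hypergraph Sg ar coar} (m : Hom G H) {v : G.V} {e : G.E}
    (h : v ∈ G.src e) : m.onV v ∈ H.src (m.onE e) :=
  m.src_eq e ▸ List.mem_map_of_mem h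

theorem Hom.mem_tgt_onE {G H : Hypergraph Sg ar coar} (m : Hom G H) {v : G.V} {e : G.E}
    (h : v ∈ G.tgt e) : m.onV v ∈ H.tgt (m.onE e) :=
  m.tgt_eq e ▸ List.mem_map_of_mem h

theorem Hom.isOutput_of_notMem_range {G H : Hypergraph Sg ar coar} (m : Hom G H)
    (hH : H.Monogamous) {v : G.V} {e : H.E} (hv : m.onV v ∈ H.src e)
    (he : e ∉ Set.range m.onE) : G.IsOutput v :=
  Hypergraph.isOutput_iff.2 fun e₀ h ↦
    he ⟨e₀, hH.eq_of_mem_src (m.mem_src_onE h) hv⟩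

theorem Hom.isInput_of_notMem_range {G H : Hypergraph Sg ar coar} (m : Hom G H)
    (hH : H.Monogamous) {v : G.V} {e : H.E} (hv : m.onV v ∈ H.tgt e)
    (he : e ∉ Set.range m.onE) : G.IsInput v :=
  Hypergraph.isInput_iff.2 fun e₀ h ↦
    he ⟨e₀, hH.eq_of_mem_tgt (m.mem_tgt_onE h) hv⟩

/-- Invariant of a node `w` reached from the image of `a` under `m`: either `w` is the image of
some node `c` of `G`, with the images of `a` and `c` under the second morphism related by `r`, or
`w` lies outside the image of `m` and is reached through an output of `G`. -/
def Tracks {G H H' : Hypergraph Sg ar coar} (m : Hom G H) (m' : Hom G H')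
    (r : H'.V → H'.V → Prop) (a : G.V) (w : H.V) : Prop :=
  (∃ c, m.onV c = w ∧ r (m'.onV a) (m'.onV c)) ∨
    (w ∉ Set.range m.onV ∧ ∃ c, G.IsOutput c ∧ Relation.TransGen (NodeStep H) (m.onV c) w ∧
      Relation.ReflTransGen (NodeStep H') (m'.onV a) (m'.onV c))

theorem Tracks.step {G H H' : Hypergraph Sg ar coar} {m : Hom G H} {m' : Hom G H'}
    (hH : H.Monogamous) (hm : Function.Injective m.onV) (hcov : PathCovers m m')
    {a : G.V} {w w' : H.V}
    (h : Tracks m m' (Relation.ReflTransGen (NodeStep H')) a w) (hw : NodeStep H w w') :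
    Tracks m m' (Relation.TransGen (NodeStep H')) a w' := by
  obtain ⟨e, hs, ht⟩ := hw
  by_cases he : e ∈ Set.range m.onE
  · obtain ⟨e, rfl⟩ := he
    rw [m.src_eq, List.mem_map] at hs
    rw [m.tgt_eq, List.mem_map] at ht
    obtain ⟨c, hc, rfl⟩ := hs
    obtain ⟨d, hd, rfl⟩ := ht
    rcases h with ⟨c', hcc, hr⟩ | ⟨hn, -⟩
    · obtain rfl := hm hcc
      exact .inl ⟨d, rfl, .tail' hr ⟨_, m'.mem_src_onE hc, m'.mem_tgt_onE hd⟩⟩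
    · exact absurd ⟨c, rfl⟩ hn
  · obtain ⟨c, hc, hcw, hr⟩ : ∃ c, G.IsOutput c ∧
        Relation.TransGen (NodeStep H) (m.onV c) w' ∧
        Relation.ReflTransGen (NodeStep H') (m'.onV a) (m'.onV c) := by
      rcases h with ⟨c, rfl, hr⟩ | ⟨-, c, hc, hcw, hr⟩
      · exact ⟨c, m.isOutput_of_notMem_range hH hs he, .single ⟨e, hs, ht⟩, hr⟩
      · exact ⟨c, hc, hcw.tail ⟨e, hs, ht⟩, hr⟩
    by_cases hw' : w' ∈ Set.range m.onV
    · obtain ⟨d, rfl⟩ := hw'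
      have hd := m.isInput_of_notMem_range hH ht he
      exact .inl ⟨d, rfl, .trans_right hr <|
        hasPath_iff_transGen.1 (hcov c d hc hd (hasPath_iff_transGen.2 hcw))⟩
    · exact .inr ⟨hw', c, hc, hcw, hr⟩

/-- Path covering transfers paths between arbitrary nodes of `G`, not only those from
outputs to inputs. -/
theorem PathCovers.hasPath {G H H' : Hypergraph Sg ar coar} {m : Hom G H} {m' : Hom G H'}
    (hH : H.Monogamous) (hm : Function.Injective m.onV) (hcov : PathCovers m m') {a b : G.V}
    (h : HasPath H (m.onV a) (m.onV b)) : HasPath H' (m'.onV a) (m'.onV b) := by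
  have key : ∀ w, Relation.TransGen (NodeStep H) (m.onV a) w →
      Tracks m m' (Relation.TransGen (NodeStep H')) a w := by
    intro w hw
    induction hw with
    | single hw => exact Tracks.step hH hm hcov (.inl ⟨a, rfl, .refl⟩) hw
    | tail _ hw ih =>
      exact Tracks.step hH hm hcov (ih.imp_left fun ⟨c, hc, hr⟩ ↦ ⟨c, hc, hr.to_reflTransGen⟩) hw
  rcases key _ (hasPath_iff_transGen.1 h) with ⟨c, hc, hr⟩ | ⟨hn, -⟩
  · obtain rfl := hm hc
    exact hasPath_iff_transGen.2 hr
  · exact absurd ⟨b, rfl⟩ hn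

/-- if `m ≲ m'` then `m ∘ k ≲ m' ∘ k` for any mono `k : K → G`
between ma-hypergraphs. -/
theorem pathCovers_comp {Sg : Type} {ar coar : Sg → ℕ}
    {K G H H' : Hypergraph Sg ar coar}
    (hK : K.IsMA) (hG : G.IsMA) (hH : H.IsMA) (hH' : H'.IsMA)
    (m : Hom G H) (m' : Hom G H') (k : Hom K G)
    (hm : IsMono m) (hm' : IsMono m') (hk : IsMono k)
    (hcov : PathCovers m m') :
    PathCovers (m.comp k) (m'.comp k) :=
  fun _ _ _ _ h ↦ hcov.hasPath hH.2 hm.1 h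

end HypRw
end

section
/- Let m : G → H be a mono of monogamous hypergraphs (every node has in-degree ≤ 1 and out-degree ≤ 1 in both G and H). If a hyperedge e of H outside the image of m has the image m(v) of a node v of G among its sources, then v is an output of G (has out-degree 0 in G); dually, if e outside the image of m has m(v) among its targets, then v is an input of G (has in-degree 0 in G). -/
namespace HypRw

variable {Sg : Type} {ar coar : Sg → ℕ}

/-- Suppose `T (φ a)` is the `g`-image of `S a` for all `a`, and `g x` occurs at most once in
the lists `T`. If it occurs in `T b` with `b` outside the range of `φ`, then `x` occurs in no
list `S a`. -/
theorem sum_count_eq_zero_of_mem_of_notMem_range {A B X Y : Type*} [Fintype A] [Fintype B]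
    [DecidableEq X] [DecidableEq Y] (S : A → List X) (T : B → List Y) (g : X → Y) (φ : A → B)
    (hT : ∀ a, T (φ a) = (S a).map g) (x : X) (h : ∑ b, (T b).count (g x) ≤ 1)
    (b : B) (hb : ¬ ∃ a, φ a = b) (hx : g x ∈ T b) : ∑ a, (S a).count x = 0 := by
  classical
  refine Finset.sum_eq_zero fun a _ => List.count_eq_zero.mpr fun ha => ?_
  have hmem : g x ∈ T (φ a) := hT a ▸ List.mem_map_of_mem ha
  have hne : φ a ≠ b := fun h' => hb ⟨a, h'⟩
  have hle : ∑ c ∈ {φ a, b}, (T c).count (g x) ≤ ∑ c, (T c).count (g x) :=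
    Finset.sum_le_sum_of_subset (Finset.subset_univ _)
  rw [Finset.sum_pair hne] at hle
  have h₁ := List.count_pos_iff.mpr hmem
  have h₂ := List.count_pos_iff.mpr hx
  omega

/-- for a mono `m : G → H` of monogamous hypergraphs, a hyperedge
of `H` outside the image of `m` can touch the image only at outputs (as a
source) resp. inputs (as a target) of `G`. -/
theorem mono_outside_edge_touches_boundary {Sg : Type} {ar coar : Sg → ℕ}
    {G H : Hypergraph Sg ar coar}
    (hG : G.Monogamous) (hH : H.Monogamous)
    (m : Hom G H) (hm : IsMono m)
    (e : H.E) (he : ¬ ∃ e₀, m.onE e₀ = e) (v : G.V) :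
    (m.onV v ∈ H.src e → G.IsOutput v) ∧ (m.onV v ∈ H.tgt e → G.IsInput v) := by
  classical
  exact ⟨sum_count_eq_zero_of_mem_of_notMem_range G.src H.src m.onV m.onE m.src_eq v
      (hH (m.onV v)).2 e he,
    sum_count_eq_zero_of_mem_of_notMem_range G.tgt H.tgt m.onV m.onE m.tgt_eq v
      (hH (m.onV v)).1 e he⟩

end HypRw
end

section
/- Let p : G' → P be a path extension of an ma-hypergraph G' over Σ, and let L be a hypergraph labelled only by Σ (containing no 𝒫-labelled hyperedges) and with no isolated vertices (every node occurs as a source or target of some hyperedge). Then every mono m : L → P factors as m = p ∘ m' for a (unique) mono m' : L → G'. -/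
namespace HypRw

variable {Sg : Type} {ar coar : Sg → ℕ}

theorem Hom.ext_of_onV_onE {G H : Hypergraph Sg ar coar} {f g : Hom G H}
    (hV : f.onV = g.onV) (hE : f.onE = g.onE) : f = g := by
  cases f; cases g; cases hV; cases hE; rfl

theorem IsMono.comp_left_cancel {G H K : Hypergraph Sg ar coar} {p : Hom H K} (hp : IsMono p)
    {f g : Hom G H} (h : p.comp f = p.comp g) : f = g :=
  Hom.ext_of_onV_onE (hp.1.comp_left (congrArg Hom.onV h)) (hp.2.comp_left (congrArg Hom.onE h))

theorem IsMono.of_comp {G H K : Hypergraph Sg ar coar} {p : Hom H K} {f : Hom G H}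
    (h : IsMono (p.comp f)) : IsMono f :=
  ⟨Function.Injective.of_comp (f := p.onV) h.1, Function.Injective.of_comp (f := p.onE) h.2⟩

/-- A morphism whose image lies in the image of a mono factors through it. -/
theorem IsMono.exists_comp_eq {G H K : Hypergraph Sg ar coar} {p : Hom H K} (hp : IsMono p)
    (m : Hom G K) (hV : ∀ v, ∃ w, p.onV w = m.onV v) (hE : ∀ e, ∃ e', p.onE e' = m.onE e) :
    ∃ f : Hom G H, p.comp f = m := by
  choose fV hfV using hV
  choose fE hfE using hE
  have hcomp : p.onV ∘ fV = m.onV := funext hfV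
  refine ⟨⟨fV, fE, fun e => ?_, fun e => ?_, fun e => ?_⟩,
    Hom.ext_of_onV_onE hcomp (funext hfE)⟩
  · rw [← p.label_eq, hfE, m.label_eq]
  · apply hp.1.list_map
    rw [← p.src_eq, hfE, m.src_eq, List.map_map, hcomp]
  · apply hp.1.list_map
    rw [← p.tgt_eq, hfE, m.tgt_eq, List.map_map, hcomp]

/-- If every hyperedge of `G` is sent into the image of `p`, then so is every non-isolated node. -/
theorem exists_onV_eq_of_exists_onE_eq {G H K : Hypergraph Sg ar coar} (p : Hom H K)
    (m : Hom G K) (hE : ∀ e, ∃ e', p.onE e' = m.onE e) {v : G.V}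
    (hv : ∃ e : G.E, v ∈ G.src e ∨ v ∈ G.tgt e) : ∃ w, p.onV w = m.onV v := by
  obtain ⟨e, hv⟩ := hv
  obtain ⟨e', he'⟩ := hE e
  rcases hv with hv | hv
  · have h : m.onV v ∈ K.src (m.onE e) := m.src_eq e ▸ List.mem_map_of_mem hv
    rw [← he', p.src_eq] at h
    obtain ⟨w, -, hw⟩ := List.mem_map.mp h
    exact ⟨w, hw⟩
  · have h : m.onV v ∈ K.tgt (m.onE e) := m.tgt_eq e ▸ List.mem_map_of_mem hv
    rw [← he', p.tgt_eq] at h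
    obtain ⟨w, -, hw⟩ := List.mem_map.mp h
    exact ⟨w, hw⟩

/-- A morphism from a Σ-labelled hypergraph into a path extension sends hyperedges into the
image of the extended hypergraph. -/
theorem IsPathExt.exists_onE_eq {G P L : EHypergraph Sg ar coar} {p : Hom G P}
    (hp : IsPathExt p) (hL : Pure L) (m : Hom L P) (e : L.E) : ∃ e', p.onE e' = m.onE e := by
  by_contra h
  have hright := hp.2 _ h
  simp [m.label_eq, ← Sum.not_isLeft, hL e] at hright

/-- every mono from a Σ-labelled hypergraph without isolated
vertices into a path extension `p : G' → P` factors uniquely through `p`. -/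
theorem mono_into_path_extension_factors {Sg : Type} {ar coar : Sg → ℕ}
    (G' P L : EHypergraph Sg ar coar)
    (hG' : G'.IsMA) (p : Hom G' P) (hp : IsPathExt p)
    (hL : Pure L)
    (hnoiso : ∀ v : L.V, ∃ e : L.E, v ∈ L.src e ∨ v ∈ L.tgt e)
    (m : Hom L P) (hm : IsMono m) :
    ∃! m' : Hom L G', IsMono m' ∧ p.comp m' = m := by
  have hE := hp.exists_onE_eq hL m
  obtain ⟨m', rfl⟩ := hp.1.exists_comp_eq m
    (fun v => exists_onV_eq_of_exists_onE_eq p m hE (hnoiso v)) hE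
  exact ⟨m', ⟨hm.of_comp, rfl⟩, fun f hf => hp.1.comp_left_cancel hf.2⟩

end HypRw
end

section
/- Boundary complements are unique up to isomorphism when they exist: given ma-cospans i → L ← j and n → G ← m, and a mono f : L → G, any two boundary complements of f with respect to these cospans are isomorphic as pushout complements. -/
namespace HypRw

variable {Sg : Type} {ar coar : Sg → ℕ}

theorem Hom.ext_of {G H : Hypergraph Sg ar coar} {p q : Hom G H}
    (hV : ∀ v, p.onV v = q.onV v) (hE : ∀ e, p.onE e = q.onE e) : p = q := by
  cases p
  cases q
  obtain rfl := funext hV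
  obtain rfl := funext hE
  rfl

theorem Hypergraph.IsOutput.not_mem_src {G : Hypergraph Sg ar coar} {v : G.V}
    (h : G.IsOutput v) (e : G.E) : v ∉ G.src e := by
  classical
  simp only [Hypergraph.IsOutput, Hypergraph.outDegree, Finset.sum_eq_zero_iff] at h
  have := h e (Finset.mem_univ e)
  rwa [List.count_eq_zero] at this

theorem Hypergraph.IsInput.not_mem_tgt {G : Hypergraph Sg ar coar} {v : G.V}
    (h : G.IsInput v) (e : G.E) : v ∉ G.tgt e := by
  classical
  simp only [Hypergraph.IsInput, Hypergraph.inDegree, Finset.sum_eq_zero_iff] at h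
  have := h e (Finset.mem_univ e)
  rwa [List.count_eq_zero] at this

/-- The hypergraph on the nodes `Y` whose hyperedges are those of `L` and `C`, attached to
nodes along `p` and `q`. -/
def glue (L C : Hypergraph Sg ar coar) {Y : Type} [Fintype Y] (p : L.V → Y) (q : C.V → Y) :
    Hypergraph Sg ar coar where
  V := Y
  E := L.E ⊕ C.E
  fintV := inferInstance
  fintE := inferInstance
  label := Sum.elim L.label C.label
  src := Sum.elim (fun e => (L.src e).map p) (fun e => (C.src e).map q)
  tgt := Sum.elim (fun e => (L.tgt e).map p) (fun e => (C.tgt e).map q)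
  src_len := by rintro (e | e) <;> simp [L.src_len, C.src_len]
  tgt_len := by rintro (e | e) <;> simp [L.tgt_len, C.tgt_len]

def glueInl (L C : Hypergraph Sg ar coar) {Y : Type} [Fintype Y] (p : L.V → Y) (q : C.V → Y) :
    Hom L (glue L C p q) where
  onV := p
  onE := Sum.inl
  label_eq _ := rfl
  src_eq _ := rfl
  tgt_eq _ := rfl

def glueInr (L C : Hypergraph Sg ar coar) {Y : Type} [Fintype Y] (p : L.V → Y) (q : C.V → Y) :
    Hom C (glue L C p q) where
  onV := q
  onE := Sum.inr
  label_eq _ := rfl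
  src_eq _ := rfl
  tgt_eq _ := rfl

def glueDesc {L C G : Hypergraph Sg ar coar} {Y : Type} [Fintype Y] {p : L.V → Y} {q : C.V → Y}
    (f : Hom L G) (g : Hom C G) (t : Y → G.V) (hp : t ∘ p = f.onV) (hq : t ∘ q = g.onV) :
    Hom (glue L C p q) G where
  onV := t
  onE := Sum.elim f.onE g.onE
  label_eq := by
    rintro (e | e)
    · exact f.label_eq e
    · exact g.label_eq e
  src_eq := by
    rintro (e | e)
    · simp [glue, f.src_eq, ← hp]
    · simp [glue, g.src_eq, ← hq]
  tgt_eq := by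
    rintro (e | e)
    · simp [glue, f.tgt_eq, ← hp]
    · simp [glue, g.tgt_eq, ← hq]

/-- Explicit description of a pushout of `L` and `C` along a discrete interface that is
injective into `C`. -/
structure IsGluing {K : Type} {L C G : Hypergraph Sg ar coar} (a : K → L.V) (c : K → C.V)
    (f : Hom L G) (g : Hom C G) : Prop where
  comm : ∀ x, f.onV (a x) = g.onV (c x)
  onE_injective : Function.Injective g.onE
  onE_disjoint : ∀ e e', f.onE e ≠ g.onE e'
  onE_cover : ∀ e, (∃ e₀, f.onE e₀ = e) ∨ ∃ e₀, g.onE e₀ = e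
  onV_cover : ∀ v, (∃ l, f.onV l = v) ∨ ∃ u, g.onV u = v
  onV_eq : ∀ u u', g.onV u = g.onV u' → u = u' ∨ ∃ x y, u = c x ∧ u' = c y ∧ a x = a y
  onV_meet : ∀ l u, f.onV l = g.onV u → ∃ x, u = c x

theorem IsPushout.isGluing {K : Type} [Fintype K] {L C G : Hypergraph Sg ar coar}
    {a : K → L.V} {c : K → C.V} {f : Hom L G} {g : Hom C G}
    (h : IsPushout (discHom L a) (discHom C c) f g) (hc : Function.Injective c) :
    IsGluing a c f g := by
  classical
  obtain ⟨hcomm, huniv⟩ := h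
  have comm (x) : f.onV (a x) = g.onV (c x) :=
    congrFun (congrArg Hom.onV hcomm) x
  let p : L.V → L.V ⊕ {u : C.V // u ∉ Set.range c} := Sum.inl
  let q : C.V → L.V ⊕ {u : C.V // u ∉ Set.range c} := fun u =>
    if hu : u ∈ Set.range c then Sum.inl (a hu.choose) else Sum.inr ⟨u, hu⟩
  have q_c (x) : q (c x) = Sum.inl (a x) := by
    have hx : c x ∈ Set.range c := ⟨x, rfl⟩
    simp only [q, dif_pos hx]
    rw [hc hx.choose_spec]
  have q_not (u) (hu : u ∉ Set.range c) : q u = Sum.inr ⟨u, hu⟩ := dif_neg hu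
  let t : L.V ⊕ {u : C.V // u ∉ Set.range c} → G.V := Sum.elim f.onV (fun u => g.onV u.1)
  have tq : t ∘ q = g.onV := by
    funext u
    by_cases hu : u ∈ Set.range c
    · obtain ⟨x, rfl⟩ := hu
      simp [q_c, t, comm]
    · simp [q_not u hu, t]
  obtain ⟨w, ⟨wf, wg⟩, -⟩ := huniv (glue L C p q) (glueInl L C p q) (glueInr L C p q)
    (Hom.ext_of (fun x => (q_c x).symm) (fun e => e.elim))
  have wfV (l) : w.onV (f.onV l) = Sum.inl l := congrFun (congrArg Hom.onV wf) l
  have wgV (u) : w.onV (g.onV u) = q u := congrFun (congrArg Hom.onV wg) u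
  have wfE (e) : w.onE (f.onE e) = Sum.inl e := congrFun (congrArg Hom.onE wf) e
  have wgE (e) : w.onE (g.onE e) = Sum.inr e := congrFun (congrArg Hom.onE wg) e
  let d := glueDesc (p := p) f g t rfl tq
  have dw : d.comp w = Hom.id G := by
    refine (huniv G f g hcomm).unique ⟨?_, ?_⟩ ⟨rfl, rfl⟩
    · refine Hom.ext_of (fun l => ?_) (fun e => ?_)
      · exact congrArg t (wfV l)
      · exact congrArg (Sum.elim f.onE g.onE) (wfE e)
    · refine Hom.ext_of (fun u => ?_) (fun e => ?_)
      · exact (congrArg t (wgV u)).trans (congrFun tq u)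
      · exact congrArg (Sum.elim f.onE g.onE) (wgE e)
  have dwV (v) : t (w.onV v) = v := congrFun (congrArg Hom.onV dw) v
  have dwE (e) : Sum.elim f.onE g.onE (w.onE e) = e := congrFun (congrArg Hom.onE dw) e
  refine ⟨comm, fun e e' he => ?_, fun e e' he => ?_, fun e => ?_, fun v => ?_,
    fun u u' hu => ?_, fun l u hu => ?_⟩
  · have := congrArg w.onE he
    rw [wgE, wgE] at this
    exact Sum.inr_injective this
  · have := congrArg w.onE he
    rw [wfE, wgE] at this
    exact Sum.inl_ne_inr this
  · rcases hw : w.onE e with e₀ | e₀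
    · exact Or.inl ⟨e₀, (congrArg (Sum.elim f.onE g.onE) hw).symm.trans (dwE e)⟩
    · exact Or.inr ⟨e₀, (congrArg (Sum.elim f.onE g.onE) hw).symm.trans (dwE e)⟩
  · rcases hw : w.onV v with l | u
    · exact Or.inl ⟨l, (congrArg t hw).symm.trans (dwV v)⟩
    · exact Or.inr ⟨u.1, (congrArg t hw).symm.trans (dwV v)⟩
  · have hq : q u = q u' := by rw [← wgV, ← wgV, hu]
    by_cases h₁ : u ∈ Set.range c <;> by_cases h₂ : u' ∈ Set.range c
    · obtain ⟨x, rfl⟩ := h₁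
      obtain ⟨y, rfl⟩ := h₂
      rw [q_c, q_c] at hq
      exact Or.inr ⟨x, y, rfl, rfl, Sum.inl_injective hq⟩
    · obtain ⟨x, rfl⟩ := h₁
      rw [q_c, q_not _ h₂] at hq
      exact (Sum.inl_ne_inr hq).elim
    · obtain ⟨y, rfl⟩ := h₂
      rw [q_c, q_not _ h₁] at hq
      exact (Sum.inr_ne_inl hq).elim
    · rw [q_not _ h₁, q_not _ h₂] at hq
      exact Or.inl (congrArg Subtype.val (Sum.inr_injective hq))
  · by_contra hne
    have hu' : u ∉ Set.range c := fun ⟨x, hx⟩ => hne ⟨x, hx.symm⟩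
    have := congrArg w.onV hu
    rw [wfV, wgV, q_not u hu'] at this
    exact Sum.inl_ne_inr this

/-- Nodes of two pushout complements correspond when they have the same image and the same
preimage in the interface. -/
def NodeMatch {K : Type} {C C' G : Hypergraph Sg ar coar} (c : K → C.V) (c' : K → C'.V)
    (g : Hom C G) (g' : Hom C' G) (u : C.V) (u' : C'.V) : Prop :=
  g.onV u = g'.onV u' ∧ ∀ x, u = c x ↔ u' = c' x

section

variable {K : Type} {L C C' G : Hypergraph Sg ar coar} {a : K → L.V} {c : K → C.V}
  {c' : K → C'.V} {f : Hom L G} {g : Hom C G} {g' : Hom C' G}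

theorem NodeMatch.symm {u : C.V} {u' : C'.V} (h : NodeMatch c c' g g' u u') :
    NodeMatch c' c g' g u' u :=
  ⟨h.1.symm, fun x => (h.2 x).symm⟩

theorem NodeMatch.right_unique (hg' : IsGluing a c' f g') (hc : Function.Injective c)
    {u : C.V} {u' u'' : C'.V} (h : NodeMatch c c' g g' u u') (h' : NodeMatch c c' g g' u u'') :
    u' = u'' := by
  obtain h₀ | ⟨x, y, hx, hy, -⟩ := hg'.onV_eq u' u'' (h.1.symm.trans h'.1)
  · exact h₀
  · have hxy : x = y := hc (((h.2 x).2 hx).symm.trans ((h'.2 y).2 hy))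
    rw [hx, hy, hxy]

theorem IsGluing.exists_nodeMatch (hg : IsGluing a c f g) (hg' : IsGluing a c' f g')
    (hc : Function.Injective c) (hc' : Function.Injective c') (u : C.V) :
    ∃ u', NodeMatch c c' g g' u u' := by
  by_cases hu : ∃ x, u = c x
  · obtain ⟨x, rfl⟩ := hu
    exact ⟨c' x, (hg.comm x).symm.trans (hg'.comm x), fun y => hc.eq_iff.trans hc'.eq_iff.symm⟩
  · obtain ⟨l, hl⟩ | ⟨u', hu'⟩ := hg'.onV_cover (g.onV u)
    · exact (hu (hg.onV_meet l u hl)).elim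
    · refine ⟨u', hu'.symm, fun x => ⟨fun h => (hu ⟨x, h⟩).elim, fun h => ?_⟩⟩
      refine (hu (hg.onV_meet (a x) u ?_)).elim
      rw [hg'.comm, ← h, hu']

theorem IsGluing.eq_of_onV_eq (hg : IsGluing a c f g) (hg' : IsGluing a c' f g')
    (hc' : Function.Injective c') {S : Set K} (ha : Set.InjOn a S) {u : C.V} {u' : C'.V}
    (hu : ∀ x, u = c x → x ∈ S) (hu' : ∀ x, u' = c' x → x ∈ S) (h : g.onV u = g'.onV u')
    {x : K} (hx : u = c x) : u' = c' x := by
  have h₁ : g'.onV u' = g'.onV (c' x) := by rw [← h, hx, ← hg.comm, hg'.comm]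
  obtain h₀ | ⟨y, z, hy, hz, hyz⟩ := hg'.onV_eq _ _ h₁
  · exact h₀
  · obtain rfl := hc' hz
    rw [hy, ha (hu' y hy) (hu x hx) hyz]

/-- Nodes with equal images match as soon as only interface points from a set on which `a` is
injective can lie over them. -/
theorem IsGluing.nodeMatch (hg : IsGluing a c f g) (hg' : IsGluing a c' f g')
    (hc : Function.Injective c) (hc' : Function.Injective c') {S : Set K} (ha : Set.InjOn a S)
    {u : C.V} {u' : C'.V} (hu : ∀ x, u = c x → x ∈ S) (hu' : ∀ x, u' = c' x → x ∈ S)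
    (h : g.onV u = g'.onV u') : NodeMatch c c' g g' u u' :=
  ⟨h, fun _ => ⟨hg.eq_of_onV_eq hg' hc' ha hu hu' h, hg'.eq_of_onV_eq hg hc ha hu' hu h.symm⟩⟩

theorem IsGluing.exists_onE_eq (hg : IsGluing a c f g) (hg' : IsGluing a c' f g') (e : C.E) :
    ∃ e', g'.onE e' = g.onE e :=
  (hg'.onE_cover (g.onE e)).resolve_left fun ⟨e₀, h⟩ => hg.onE_disjoint e₀ e h

end

theorem eq_map_of_map_eq_map {α β γ : Type*} {p : α → γ} {q : β → γ} {t : α → β} :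
    ∀ {l : List α} {l' : List β}, l.map p = l'.map q →
      (∀ v ∈ l, ∀ v' ∈ l', p v = q v' → t v = v') → l' = l.map t
  | [], [], _, _ => rfl
  | [], _ :: _, h, _ => by simp at h
  | _ :: _, [], h, _ => by simp at h
  | v :: l, v' :: l', h, H => by
    rw [List.map_cons, List.map_cons, List.cons.injEq] at h
    rw [List.map_cons, H v (by simp) v' (by simp) h.1,
      ← eq_map_of_map_eq_map (t := t) h.2 fun x hx y hy => H x (by simp [hx]) y (by simp [hy])]

section

variable {i j n m : ℕ} {L G : Hypergraph Sg ar coar} {a1 : Fin i → L.V} {a2 : Fin j → L.V}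
  {b1 : Fin n → G.V} {b2 : Fin m → G.V} {f : Hom L G}

theorem BoundaryComplement.isGluing (B : BoundaryComplement a1 a2 b1 b2 f) :
    IsGluing (Sum.elim a1 a2) (Sum.elim B.c1 B.c2) f B.g :=
  B.po.isGluing B.c_mono

theorem BoundaryComplement.c1_isOutput (B : BoundaryComplement a1 a2 b1 b2 f) (x : Fin i) :
    B.C.IsOutput (B.c1 x) :=
  B.bc_ma.2.2.2.2.subset ⟨Sum.inr x, rfl⟩

theorem BoundaryComplement.c2_isInput (B : BoundaryComplement a1 a2 b1 b2 f) (x : Fin j) :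
    B.C.IsInput (B.c2 x) :=
  B.bc_ma.2.2.1.subset ⟨Sum.inl x, rfl⟩

theorem BoundaryComplement.mem_range_inr_of_mem_src (B : BoundaryComplement a1 a2 b1 b2 f)
    {e : B.C.E} {u : B.C.V} (hu : u ∈ B.C.src e) :
    ∀ x, u = Sum.elim B.c1 B.c2 x → x ∈ Set.range (Sum.inr : Fin j → Fin i ⊕ Fin j)
  | Sum.inl x, h => ((B.c1_isOutput x).not_mem_src e (h.subst (motive := (· ∈ _)) hu)).elim
  | Sum.inr x, _ => ⟨x, rfl⟩

theorem BoundaryComplement.mem_range_inl_of_mem_tgt (B : BoundaryComplement a1 a2 b1 b2 f)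
    {e : B.C.E} {u : B.C.V} (hu : u ∈ B.C.tgt e) :
    ∀ x, u = Sum.elim B.c1 B.c2 x → x ∈ Set.range (Sum.inl : Fin i → Fin i ⊕ Fin j)
  | Sum.inl x, _ => ⟨x, rfl⟩
  | Sum.inr x, h => ((B.c2_isInput x).not_mem_tgt e (h.subst (motive := (· ∈ _)) hu)).elim

theorem BoundaryComplement.exists_hom (ha1 : Function.Injective a1)
    (ha2 : Function.Injective a2) (B B' : BoundaryComplement a1 a2 b1 b2 f) :
    ∃ φ : Hom B.C B'.C,
      (∀ u, NodeMatch (Sum.elim B.c1 B.c2) (Sum.elim B'.c1 B'.c2) B.g B'.g u (φ.onV u)) ∧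
      ∀ e, B'.g.onE (φ.onE e) = B.g.onE e := by
  have hg := B.isGluing
  have hg' := B'.isGluing
  choose t ht using hg.exists_nodeMatch hg' B.c_mono B'.c_mono
  choose s hs using hg.exists_onE_eq hg'
  refine ⟨⟨t, s, fun e => ?_, fun e => ?_, fun e => ?_⟩, ht, hs⟩
  · rw [← B'.g.label_eq, hs, B.g.label_eq]
  · refine eq_map_of_map_eq_map (p := B.g.onV) (q := B'.g.onV) ?_ fun v hv v' hv' h => ?_
    · rw [← B.g.src_eq, ← B'.g.src_eq, hs]
    · refine (ht v).right_unique hg' B.c_mono (hg.nodeMatch hg' B.c_mono B'.c_mono ?_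
        (B.mem_range_inr_of_mem_src hv) (B'.mem_range_inr_of_mem_src hv') h)
      rintro _ ⟨x, rfl⟩ _ ⟨y, rfl⟩ hxy
      exact congrArg Sum.inr (ha2 hxy)
  · refine eq_map_of_map_eq_map (p := B.g.onV) (q := B'.g.onV) ?_ fun v hv v' hv' h => ?_
    · rw [← B.g.tgt_eq, ← B'.g.tgt_eq, hs]
    · refine (ht v).right_unique hg' B.c_mono (hg.nodeMatch hg' B.c_mono B'.c_mono ?_
        (B.mem_range_inl_of_mem_tgt hv) (B'.mem_range_inl_of_mem_tgt hv') h)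
      rintro _ ⟨x, rfl⟩ _ ⟨y, rfl⟩ hxy
      exact congrArg Sum.inl (ha1 hxy)

theorem BoundaryComplement.comp_eq_id {B B' : BoundaryComplement a1 a2 b1 b2 f}
    {φ : Hom B.C B'.C} {ψ : Hom B'.C B.C}
    (hφ : ∀ u, NodeMatch (Sum.elim B.c1 B.c2) (Sum.elim B'.c1 B'.c2) B.g B'.g u (φ.onV u))
    (hφE : ∀ e, B'.g.onE (φ.onE e) = B.g.onE e)
    (hψ : ∀ u, NodeMatch (Sum.elim B'.c1 B'.c2) (Sum.elim B.c1 B.c2) B'.g B.g u (ψ.onV u))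
    (hψE : ∀ e, B.g.onE (ψ.onE e) = B'.g.onE e) :
    φ.comp ψ = Hom.id B'.C := by
  refine Hom.ext_of (fun v => ?_) fun e => ?_
  · exact (hφ (ψ.onV v)).right_unique B'.isGluing B.c_mono (hψ v).symm
  · exact B'.isGluing.onE_injective ((hφE _).trans (hψE e))

end

/-- boundary complements are unique (up to an isomorphism
compatible with the pushout-complement structure) when they exist. -/
theorem boundaryComplement_unique {Sg : Type} {ar coar : Sg → ℕ}
    {i j n m : ℕ} {L G : Hypergraph Sg ar coar}
    {a1 : Fin i → L.V} {a2 : Fin j → L.V}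
    {b1 : Fin n → G.V} {b2 : Fin m → G.V}
    (hL : IsMACospan L a1 a2) (hG : IsMACospan G b1 b2)
    (f : Hom L G) (hf : IsMono f)
    (B1 B2 : BoundaryComplement a1 a2 b1 b2 f) :
    ∃ (φ : Hom B1.C B2.C) (ψ : Hom B2.C B1.C),
      φ.comp ψ = Hom.id B2.C ∧ ψ.comp φ = Hom.id B1.C ∧
      φ.onV ∘ Sum.elim B1.c1 B1.c2 = Sum.elim B2.c1 B2.c2 ∧
      B2.g.comp φ = B1.g := by
  obtain ⟨φ, hφ, hφE⟩ := B1.exists_hom hL.2.1 hL.2.2.2.1 B2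
  obtain ⟨ψ, hψ, hψE⟩ := B2.exists_hom hL.2.1 hL.2.2.2.1 B1
  refine ⟨φ, ψ, BoundaryComplement.comp_eq_id hφ hφE hψ hψE,
    BoundaryComplement.comp_eq_id hψ hψE hφ hφE, funext fun x => ((hφ _).2 x).1 rfl,
    Hom.ext_of (fun v => (hφ v).1.symm) hφE⟩

end HypRw
end
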